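/- Linearization of the exponential mirror-descent weight under bounded mini-batch noise: let a ∈ ℝ and let α > 0 satisfy α E∞ ≤ √(2 log 8). Then | E[ exp(−α(a + m^{−1} ∑_{l=1}^m ξ_l)) ] − (1 − α a) | ≤ (4 α² E∞² / m) · e^{−α a} + (α² a² / 2) · e^{α|a|}. -/

import Mathlib

/-!
STATEMENT 17 (Linearization of the exponential mirror-descent weight under bounded
mini-batch noise): let ξ₁, …, ξ_m be i.i.d., centered, a.s. bounded by E∞, and let
α > 0 satisfy α E∞ ≤ √(2 log 8).  Then for every a ∈ ℝ,
|E[exp(−α(a + m⁻¹ ∑ ξ_l))] − (1 − α a)| ≤ (4α²E∞²/m)e^{−αa} + (α²a²/2)e^{α|a|}.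
-/

open MeasureTheory ProbabilityTheory
open scoped BigOperators

noncomputable section

/-- Quadratic remainder bound for the exponential, valid on the whole real line. -/
theorem Real.exp_sub_one_sub_self_le (t : ℝ) :
    Real.exp t - 1 - t ≤ t ^ 2 / 2 * Real.exp |t| := by
  have hmono : MonotoneOn (fun u : ℝ => (1 + u) * Real.exp (-u) + u ^ 2 / 2) (Set.Ici 0) := by
    have hderiv (u : ℝ) : HasDerivAt (fun u : ℝ => (1 + u) * Real.exp (-u) + u ^ 2 / 2)
        (u * (1 - Real.exp (-u))) u := by
      have h := (((hasDerivAt_id u).const_add 1).mul (hasDerivAt_id u).neg.exp).add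
        (((hasDerivAt_id u).pow 2).div_const 2)
      refine h.congr_deriv ?_
      simp only [id, Pi.neg_apply]
      ring
    refine monotoneOn_of_deriv_nonneg (convex_Ici 0)
      (fun u _ => (hderiv u).continuousAt.continuousWithinAt)
      (fun u _ => (hderiv u).differentiableAt.differentiableWithinAt) fun u hu => ?_
    rw [interior_Ici, Set.mem_Ioi] at hu
    rw [(hderiv u).deriv]
    exact mul_nonneg hu.le (sub_nonneg.2 (Real.exp_le_one_iff.2 (neg_nonpos.2 hu.le)))
  have hpos (u : ℝ) (hu : 0 ≤ u) : Real.exp u - 1 - u ≤ u ^ 2 / 2 * Real.exp u := by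
    have h := hmono Set.self_mem_Ici hu hu
    simp only [add_zero, neg_zero, Real.exp_zero, mul_one, ne_eq, OfNat.ofNat_ne_zero,
      not_false_eq_true, zero_pow, zero_div] at h
    have h' := mul_le_mul_of_nonneg_right h (Real.exp_pos u).le
    have hinv : Real.exp (-u) * Real.exp u = 1 := by rw [← Real.exp_add]; simp
    linear_combination h' + (1 + u) * hinv
  have habs : Real.exp t - 1 - t ≤ Real.exp |t| - 1 - |t| := by
    rcases le_total 0 t with ht | ht
    · rw [abs_of_nonneg ht]
    · have h := Real.self_le_sinh_iff.2 (neg_nonneg.2 ht)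
      rw [Real.sinh_eq, neg_neg] at h
      rw [abs_of_nonpos ht]
      linarith
  simpa only [sq_abs] using habs.trans (hpos |t| (abs_nonneg t))

/-- Hoeffding's bound for the moment generating function of a sum of independent centered
random variables bounded by `b`. -/
theorem hasSubgaussianMGF_sum_of_abs_le {Ω ι : Type*} [Fintype ι] [MeasurableSpace Ω]
    {P : Measure Ω} [IsProbabilityMeasure P] {b : NNReal} {ξ : ι → Ω → ℝ}
    (hmeas : ∀ l, AEMeasurable (ξ l) P) (hindep : iIndepFun ξ P)
    (hmean : ∀ l, ∫ ω, ξ l ω ∂P = 0) (hbdd : ∀ l, ∀ᵐ ω ∂P, |ξ l ω| ≤ b) :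
    HasSubgaussianMGF (fun ω => ∑ l, ξ l ω) (Fintype.card ι * b ^ 2) P := by
  have hterm (l : ι) : HasSubgaussianMGF (ξ l) (b ^ 2) P := by
    have h := hasSubgaussianMGF_of_mem_Icc_of_integral_eq_zero (a := -(b : ℝ)) (b := b)
      (hmeas l) ((hbdd l).mono fun ω h => abs_le.1 h) (hmean l)
    convert h using 1
    ext
    simp only [NNReal.coe_pow, NNReal.coe_div, coe_nnnorm, NNReal.coe_ofNat, Real.norm_eq_abs]
    rw [sub_neg_eq_add, abs_of_nonneg (by positivity)]
    ring
  have h := HasSubgaussianMGF.sum_of_iIndepFun hindep (s := Finset.univ) fun l _ => hterm l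
  simpa using h

/-- The moment generating function of a centered random variable is at least one. -/
theorem one_le_mgf_of_integral_eq_zero {Ω : Type*} [MeasurableSpace Ω] {P : Measure Ω}
    [IsProbabilityMeasure P] {X : Ω → ℝ} {t : ℝ} (hX : Integrable X P)
    (hexp : Integrable (fun ω => Real.exp (t * X ω)) P) (hmean : ∫ ω, X ω ∂P = 0) :
    1 ≤ mgf X P t := by
  have h := integral_mono ((hX.const_mul t).add (integrable_const (1 : ℝ))) hexp
    fun ω => Real.add_one_le_exp (t * X ω)
  simp only [Pi.add_apply] at h
  rw [integral_add (hX.const_mul t) (integrable_const _), integral_const_mul, hmean] at h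
  simpa [mgf] using h

theorem mirror_descent_linearization
    {Ω : Type*} [MeasurableSpace Ω] (P : Measure Ω) [IsProbabilityMeasure P]
    (m : ℕ) (hm : 1 ≤ m)
    (Einf : ℝ) (hEinf : 0 < Einf)
    (ξ : Fin m → Ω → ℝ)
    (hmeas : ∀ l, Measurable (ξ l))
    (hindep : iIndepFun ξ P)
    (hident : ∀ l l', IdentDistrib (ξ l) (ξ l') P P)
    (hmean : ∀ l, ∫ ω, ξ l ω ∂P = 0)
    (hbdd : ∀ l, ∀ᵐ ω ∂P, |ξ l ω| ≤ Einf)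
    (a α : ℝ) (hα : 0 < α) (hαE : α * Einf ≤ Real.sqrt (2 * Real.log 8)) :
    |(∫ ω, Real.exp (-(α * (a + (m : ℝ)⁻¹ * ∑ l, ξ l ω))) ∂P) - (1 - α * a)|
      ≤ 4 * α ^ 2 * Einf ^ 2 / m * Real.exp (-(α * a))
        + α ^ 2 * a ^ 2 / 2 * Real.exp (α * |a|) := by
  have hm0 : (1 : ℝ) ≤ m := by exact_mod_cast hm
  have hS : HasSubgaussianMGF (fun ω => ∑ l, ξ l ω) (m * Einf.toNNReal ^ 2) P := by
    simpa using hasSubgaussianMGF_sum_of_abs_le (b := Einf.toNNReal)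
      (fun l => (hmeas l).aemeasurable) hindep hmean
      (by simpa [Real.coe_toNNReal _ hEinf.le] using hbdd)
  have hint (l : Fin m) : Integrable (ξ l) P :=
    .of_bound (hmeas l).aestronglyMeasurable Einf (hbdd l)
  set M := mgf (fun ω => ∑ l, ξ l ω) P (-(α / m)) with hM
  have hM_ge : 1 ≤ M := one_le_mgf_of_integral_eq_zero
    (integrable_finsetSum _ fun l _ => hint l) (hS.integrable_exp_mul _)
    (by rw [integral_finsetSum _ fun l _ => hint l]; simp [hmean])
  set x := α ^ 2 * Einf ^ 2 / (2 * m) with hx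
  have hM_le : M ≤ Real.exp x := by
    refine (hS.mgf_le _).trans_eq ?_
    congr 1
    simp only [NNReal.coe_mul, NNReal.coe_natCast, NNReal.coe_pow,
      Real.coe_toNNReal _ hEinf.le, hx]
    field_simp
  have hx0 : 0 ≤ x := by positivity
  have hx_le : x ≤ Real.log 8 := by
    have hlog : 0 ≤ Real.log 8 := Real.log_nonneg (by norm_num)
    have hsq : (α * Einf) ^ 2 ≤ 2 * Real.log 8 :=
      (Real.le_sqrt (by positivity) (by positivity)).1 hαE
    rw [hx, div_le_iff₀ (by positivity)]
    nlinarith [mul_nonneg hlog (sub_nonneg.2 hm0)]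
  have hexp_le : Real.exp x ≤ 8 := by
    simpa [Real.exp_log] using Real.exp_le_exp.2 hx_le
  have hM_sub : M - 1 ≤ 4 * α ^ 2 * Einf ^ 2 / m := by
    have hinv : Real.exp (-x) * Real.exp x = 1 := by rw [← Real.exp_add]; simp
    have h := mul_le_mul_of_nonneg_right (Real.add_one_le_exp (-x)) (Real.exp_pos x).le
    have h8 : x * Real.exp x ≤ x * 8 := mul_le_mul_of_nonneg_left hexp_le hx0
    have heq : 4 * α ^ 2 * Einf ^ 2 / m = x * 8 := by rw [hx]; field_simp; norm_num
    rw [heq]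
    linarith
  have hfactor : ∫ ω, Real.exp (-(α * (a + (m : ℝ)⁻¹ * ∑ l, ξ l ω))) ∂P
      = Real.exp (-(α * a)) * M := by
    rw [hM, mgf, ← integral_const_mul]
    refine integral_congr_ae (.of_forall fun ω => ?_)
    simp only [← Real.exp_add]
    congr 1
    ring
  have hquad := Real.exp_sub_one_sub_self_le (-(α * a))
  rw [abs_neg, abs_mul, abs_of_pos hα] at hquad
  have hlin := Real.add_one_le_exp (-(α * a))
  have hprod := mul_le_mul_of_nonneg_right hM_sub (Real.exp_pos (-(α * a))).le
  have hprod0 := mul_nonneg (sub_nonneg.2 hM_ge) (Real.exp_pos (-(α * a))).le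
  rw [hfactor, abs_of_nonneg (by linarith)]
  linear_combination hprod + hquad

end
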